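/- Let X be an alphabet having n ≥ 2 letters and let g, h: X* → X* be growing morphisms. Let t ≥ 2 be an integer and let d be a positive integer such that PER(g^d(z)) ≥ (1/t)|g^d(z)| for all z ∈ X. Define e = d + 2n − 1, β(w) = |g(w)| − |h(w)| for w ∈ X*, and B = max over z ∈ X of |β(g^e(z))|. Let m be a positive integer such that |g^d(z)| > 2tm for all z ∈ X and B ≤ m/(n²+1). Then for every w ∈ X*: {g^i(w) : i ≥ 0} ⊆ COMP(g, h) if and only if {g^i(w) : i = 0, 1, …, e + 2n² + 2n − 3} ⊆ COMP(g, h). -/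

import Mathlib

open Filter Set

variable {X : Type*}

/-- Apply the morphism with letter images `g` to a word. -/
def applyM (g : X → List X) (w : List X) : List X := w.flatMap g

/-- `iterM g k w` is `g^k(w)`. -/
def iterM (g : X → List X) (k : ℕ) (w : List X) : List X := (applyM g)^[k] w

/-- The letter map of the composition `g ∘ h` (first `h`, then `g`). -/
def compM (g h : X → List X) : X → List X := fun a => applyM g (h a)

/-- The letter map of the power `g^k`. -/
def powM (g : X → List X) (k : ℕ) : X → List X := fun a => iterM g k [a]

/-- A morphism is primitive if some power maps every letter to a word containing every letter. -/
def Primitive (g : X → List X) : Prop := ∃ k : ℕ, 0 < k ∧ ∀ a b : X, a ∈ iterM g k [b]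

/-- `Mg g` is the maximal length of the image of a letter. -/
def Mg [Fintype X] (g : X → List X) : ℕ := Finset.univ.sup fun x => (g x).length

/-- A morphism is growing if the lengths of iterated images of every letter tend to infinity. -/
def Growing (g : X → List X) : Prop :=
  ∀ x : X, Tendsto (fun i => (iterM g i [x]).length) atTop atTop

/-- `w` is a (finite) prefix of the infinite word `s`. -/
def IsPrefI (w : List X) (s : ℕ → X) : Prop := ∀ i (h : i < w.length), w[i]'h = s i

/-- `v` is a factor of the infinite word `s`. -/
def IsFactorI (v : List X) (s : ℕ → X) : Prop :=
  ∃ j : ℕ, ∀ i (h : i < v.length), v[i]'h = s (j + i)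

/-- `g^ω(x)` exists. -/
def OmegaExists (g : X → List X) (x : X) : Prop :=
  [x] <+: g x ∧ Tendsto (fun i => (iterM g i [x]).length) atTop atTop

/-- `s = g^ω(x)`. -/
def IsOmega (g : X → List X) (x : X) (s : ℕ → X) : Prop :=
  OmegaExists g x ∧ ∀ i : ℕ, IsPrefI (iterM g i [x]) s

/-- `s = u^ω` for the nonempty word `u`. -/
def IsPeriodicWord (s : ℕ → X) (u : List X) : Prop :=
  u ≠ [] ∧ ∀ (i : ℕ) (h : i % u.length < u.length), s i = u[i % u.length]'h

/-- A morphism is looping. -/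
def Looping (g : X → List X) : Prop :=
  ∃ k : ℕ, 0 < k ∧ ∃ x : X, ∃ u : List X, ∃ s : ℕ → X,
    IsOmega (powM g k) x s ∧ IsPeriodicWord s u

/-- A morphism is loop-free if it is not looping. -/
def LoopFree (g : X → List X) : Prop := ¬ Looping g

/-- `p` is a period of `u`. -/
def HasPeriod (u : List X) (p : ℕ) : Prop :=
  0 < p ∧ ∀ i : ℕ, i + p < u.length → u[i + p]? = u[i]?

/-- The smallest period of `u`. -/
noncomputable def PER (u : List X) : ℕ := sInf {p | HasPeriod u p}

/-- A primitive word: nonempty and not a proper power of a shorter word. -/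
def PrimitiveWord (u : List X) : Prop :=
  u ≠ [] ∧ ¬∃ (v : List X) (j : ℕ), 2 ≤ j ∧ v.length < u.length ∧
    u = (List.replicate j v).flatten

/-- `COMP g h` : the set of words whose images under `g` and `h` are prefix-comparable. -/
def COMP (g h : X → List X) : Set (List X) :=
  {w | ∃ u₁ u₂ : List X, applyM g w ++ u₁ = applyM h w ++ u₂}

/-- `BAL g h`. -/
noncomputable def BAL (g h : X → List X) : ℕ∞ :=
  ⨆ (x : X) (k : ℕ),
    ((((applyM g (iterM g k [x])).length : ℤ) -
      ((applyM h (iterM g k [x])).length : ℤ)).natAbs : ℕ∞)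

/-- The set of factors of length `q` of the word `w`. -/
def Fq (q : ℕ) (w : List X) : Set (List X) := {v | v.length = q ∧ v <:+: w}

/-- The set of factors of length `q` of words of `L`. -/
def FqL (q : ℕ) (L : Set (List X)) : Set (List X) := ⋃ w ∈ L, Fq q w

/-- `A n = ⌊9 n³ √(n log n)⌋`. -/
noncomputable def Abound (n : ℕ) : ℕ := ⌊9 * (n : ℝ)^3 * Real.sqrt (n * Real.log n)⌋₊
/-- Prefix comparability of two words. -/
def Cmp {X : Type*} (a b : List X) : Prop := ∃ u v : List X, a ++ u = b ++ v

lemma Cmp.of_append {X : Type*} {a b x y : List X} (h : Cmp (a ++ x) (b ++ y)) : Cmp a b := by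
  obtain ⟨u, v, h⟩ := h
  exact ⟨x ++ u, y ++ v, by simpa using h⟩

lemma Cmp.cancel {X : Type*} {c x y : List X} (h : Cmp (c ++ x) (c ++ y)) : Cmp x y := by
  obtain ⟨u, v, h⟩ := h
  exact ⟨u, v, by simpa using h⟩

lemma Cmp.add {X : Type*} {c x y : List X} (h : Cmp x y) : Cmp (c ++ x) (c ++ y) := by
  obtain ⟨u, v, h⟩ := h
  exact ⟨u, v, by simpa using h⟩

lemma Cmp.get {X : Type*} {a b : List X} (h : Cmp a b) {i : ℕ} (ha : i < a.length)
    (hb : i < b.length) : a[i]? = b[i]? := by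
  obtain ⟨u, v, h⟩ := h
  have := congrArg (fun l => l[i]?) h
  simpa [List.getElem?_append, ha, hb] using this

lemma overhang {X : Type*} (a' ga b' hb : List X) (h : Cmp (a' ++ ga) (b' ++ hb)) (s : ℤ)
    (hs : s = ((a' ++ ga).length : ℤ) - ((b' ++ hb).length : ℤ))
    (h1 : s.toNat ≤ ga.length) (h2 : (-s).toNat ≤ hb.length) :
    ∃ c, a' ++ ga = c ++ ga.drop (ga.length - s.toNat) ∧
      b' ++ hb = c ++ hb.drop (hb.length - (-s).toNat) := by
  obtain ⟨u, v, h⟩ := h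
  simp only [List.length_append] at hs
  have e1 : a'.length + (ga.length - s.toNat) = b'.length + (hb.length - (-s).toNat) := by
    push_cast at hs
    omega
  have key : a' ++ ga.take (ga.length - s.toNat) = b' ++ hb.take (hb.length - (-s).toNat) := by
    have := congrArg (List.take (a'.length + (ga.length - s.toNat))) h
    rw [List.append_assoc, List.take_length_add_append, e1, List.append_assoc,
      List.take_length_add_append, List.take_append_of_le_length (by omega),
      List.take_append_of_le_length (by omega)] at this
    exact this
  refine ⟨a' ++ ga.take (ga.length - s.toNat), ?_, ?_⟩
  · simp
  · rw [key]; simp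

/-- The balance of a word. -/
def shf {X : Type*} (G H : X → List X) (u : List X) : ℤ :=
  ((u.flatMap G).length : ℤ) - ((u.flatMap H).length : ℤ)

lemma shf_append {X : Type*} (G H : X → List X) (u v : List X) :
    shf G H (u ++ v) = shf G H u + shf G H v := by
  simp only [shf, List.flatMap_append, List.length_append]; push_cast; ring

/-- Comparability of the two images. -/
def Cw {X : Type*} (G H : X → List X) (u : List X) : Prop := Cmp (u.flatMap G) (u.flatMap H)

lemma Cw.pre {X : Type*} {G H : X → List X} {u v : List X} (h : Cw G H (u ++ v)) : Cw G H u := by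
  unfold Cw at h
  rw [List.flatMap_append, List.flatMap_append] at h
  exact h.of_append

lemma Cw.next {X : Type*} {G H : X → List X} {u v : List X} {z : X}
    (h : Cw G H (u ++ z :: v)) : Cw G H (u ++ [z]) := by
  apply Cw.pre (v := v); simpa using h

lemma match_get {X : Type*} {G H : X → List X} {p : List X} {z : X}
    (h : Cw G H (p ++ [z])) {l k : ℕ} (hk : (k : ℤ) = l + shf G H p)
    (hl : l < (G z).length) (hk' : k < (H z).length) : (G z)[l]? = (H z)[k]? := by
  unfold Cw at h
  simp only [shf] at hk
  have e : (p.flatMap G).length + l = (p.flatMap H).length + k := by omega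
  have := h.get (i := (p.flatMap G).length + l)
    (by rw [List.flatMap_append, List.length_append, List.flatMap_singleton]; omega)
    (by rw [List.flatMap_append, List.length_append, List.flatMap_singleton]; omega)
  conv at this => rhs; rw [e]
  simpa [List.getElem?_append] using this

lemma uniq_aux {X : Type*} {G H : X → List X} {m B : ℕ} {z : X} {x M y : List X}
    (hG : G z = x ++ M ++ y) (hx : m ≤ x.length) (hy : m + B ≤ y.length)
    (hB : (shf G H [z]).natAbs ≤ B) (hM : ∀ δ, δ ≤ 2 * m → ¬ HasPeriod M δ)
    {p q : List X} (hp : Cw G H (p ++ [z])) (hq : Cw G H (q ++ [z]))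
    (hpm : (shf G H p).natAbs ≤ m) (hqm : (shf G H q).natAbs ≤ m)
    (hlt : shf G H p < shf G H q) : False := by
  obtain ⟨δ, hδ⟩ : ∃ δ : ℕ, (δ : ℤ) = shf G H q - shf G H p :=
    ⟨(shf G H q - shf G H p).toNat, by omega⟩
  apply hM δ (by omega)
  refine ⟨by omega, fun i hi => ?_⟩
  have hlen : (G z).length = x.length + M.length + y.length := by simp [hG, Nat.add_assoc]
  have hB' : (((G z).length : ℤ) - ((H z).length : ℤ)).natAbs ≤ B := by simpa [shf] using hB
  obtain ⟨k, hk⟩ : ∃ k : ℕ, (k : ℤ) = (x.length + i : ℕ) + shf G H q :=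
    ⟨((x.length + i : ℕ) + shf G H q).toNat, by omega⟩
  have a1 := match_get hq hk (by omega) (by omega)
  have a2 := match_get hp (l := x.length + (i + δ)) (k := k) (by push_cast at *; omega)
    (by omega) (by omega)
  have a3 := a2.trans a1.symm
  rw [hG, List.append_assoc] at a3
  simp only [List.getElem?_append_right (Nat.le_add_right _ _), Nat.add_sub_cancel_left] at a3
  rwa [List.getElem?_append_left (by omega), List.getElem?_append_left (by omega)] at a3

/-- Uniqueness of shifts. -/
def UniqS {X : Type*} (G H : X → List X) (m : ℕ) : Prop :=
  ∀ (z : X) (p q : List X), Cw G H (p ++ [z]) → Cw G H (q ++ [z]) →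
    (shf G H p).natAbs ≤ m → (shf G H q).natAbs ≤ m → shf G H p = shf G H q

open Classical in
lemma bound_shf {X : Type*} [Fintype X] {G H : X → List X} {m B : ℕ}
    (hU : UniqS G H m) (hB : ∀ z, (shf G H [z]).natAbs ≤ B) (hm : Fintype.card X * B ≤ m) :
    ∀ (N : ℕ) (u : List X), u.length ≤ N → Cw G H u →
      (shf G H u).natAbs ≤ u.toFinset.card * B := by
  have hle : ∀ u : List X, u.toFinset.card * B ≤ m := fun u =>
    (Nat.mul_le_mul_right _ (Finset.card_le_univ _)).trans hm
  intro N
  induction N with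
  | zero =>
    intro u hu _
    have : u = [] := List.length_eq_zero_iff.1 (by omega)
    subst this; simp [shf]
  | succ N ih =>
    intro u hu hc
    rcases List.eq_nil_or_concat u with rfl | ⟨u', z, rfl⟩
    · simp [shf]
    · rw [List.concat_eq_append] at *
      simp only [List.length_append, List.length_singleton] at hu
      have i1 := ih u' (by omega) hc.pre
      obtain ⟨a, hza, hs, ha, hsub⟩ : ∃ a : List X, z ∉ a ∧ shf G H a = shf G H u' ∧
          (shf G H a).natAbs ≤ a.toFinset.card * B ∧ a ⊆ u' := by
        by_cases hz : z ∈ u'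
        · obtain ⟨a, b, hab, hza⟩ := List.eq_append_cons_of_mem hz
          have hca : Cw G H (a ++ [z]) := by
            have := hc.pre; rw [hab] at this; exact this.next
          have hl := congrArg List.length hab
          simp only [List.length_append, List.length_cons] at hl
          have i2 := ih a (by omega) hca.pre
          exact ⟨a, hza, hU z a u' hca hc (i2.trans (hle _)) (i1.trans (hle _)), i2,
            by rw [hab]; exact List.subset_append_left _ _⟩
        · exact ⟨u', hz, rfl, i1, List.Subset.refl _⟩
      have hcard : a.toFinset.card + 1 ≤ (u' ++ [z]).toFinset.card := by
        rw [← Finset.card_insert_of_notMem (a := z) (by simpa using hza)]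
        apply Finset.card_le_card
        intro y hy
        simp only [Finset.mem_insert, List.mem_toFinset] at hy
        simp only [List.mem_toFinset, List.mem_append, List.mem_singleton]
        rcases hy with rfl | hy
        · exact Or.inr rfl
        · exact Or.inl (hsub hy)
      have := Nat.mul_le_mul_right B hcard
      rw [shf_append, ← hs]
      have := hB z
      have := Int.natAbs_add_le (shf G H a) (shf G H [z])
      rw [Nat.add_mul] at *
      omega

/-- `z` occurs in `w` directly after `o` (`none` meaning at the start). -/
def Occ {X : Type*} (w : List X) (o : Option X) (z : X) : Prop :=
  ∃ u v, w = u ++ z :: v ∧ u.getLast? = o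

lemma extend_step {X : Type*} {G H : X → List X} {m : ℕ}
    (hGl : ∀ z, m ≤ (G z).length) (hHl : ∀ z, m ≤ (H z).length)
    {u v : List X} {z : X} (hl : u.getLast? = v.getLast?) (hs : shf G H u = shf G H v)
    (hm : (shf G H u).natAbs ≤ m) (hu : Cw G H u) (hv : Cw G H (v ++ [z])) :
    Cw G H (u ++ [z]) := by
  rcases List.eq_nil_or_concat u with rfl | ⟨u', a, rfl⟩
  · have : v = [] := by
      simpa [eq_comm] using hl
    subst this; exact hv
  rcases List.eq_nil_or_concat v with rfl | ⟨v', b, rfl⟩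
  · simp at hl
  have hab : a = b := by simpa using hl
  subst hab
  have hvc := hv.pre
  unfold Cw at *
  simp only [List.concat_eq_append, List.flatMap_append, List.flatMap_singleton] at *
  obtain ⟨c, hc1, hc2⟩ := overhang _ _ _ _ hu (shf G H (u' ++ [a]))
    (by simp [shf]) (by have := hGl a; omega) (by have := hHl a; omega)
  obtain ⟨c', hc1', hc2'⟩ := overhang _ _ _ _ hvc (shf G H (u' ++ [a]))
    (by rw [hs]; simp [shf]) (by have := hGl a; omega) (by have := hHl a; omega)
  rw [hc1', hc2', List.append_assoc, List.append_assoc] at hv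
  rw [hc1, hc2, List.append_assoc, List.append_assoc]
  exact hv.cancel.add

lemma abstract_comp {X : Type*} [Fintype X] {G H : X → List X} {m B : ℕ}
    (hU : UniqS G H m) (hB : ∀ z, (shf G H [z]).natAbs ≤ B) (hm : Fintype.card X * B ≤ m)
    (hGl : ∀ z, m ≤ (G z).length) (hHl : ∀ z, m ≤ (H z).length)
    (L : Set (List X)) (hL : ∀ w ∈ L, Cw G H w) (w : List X)
    (hw : ∀ o z, Occ w o z → ∃ w' ∈ L, Occ w' o z) : Cw G H w := by
  classical
  have bd : ∀ u, Cw G H u → (shf G H u).natAbs ≤ m := fun u hu =>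
    (bound_shf hU hB hm u.length u le_rfl hu).trans
      ((Nat.mul_le_mul_right _ (Finset.card_le_univ _)).trans hm)
  have main : ∀ (u : List X) v, w = u ++ v → Cw G H u ∧
      ∀ z v', v = z :: v' → ∃ u₁, Cw G H (u₁ ++ [z]) ∧ u₁.getLast? = u.getLast? ∧
        shf G H u₁ = shf G H u := by
    intro u
    induction u using List.reverseRecOn with
    | nil =>
      intro v hv
      refine ⟨⟨[], [], rfl⟩, ?_⟩
      rintro z v' rfl
      obtain ⟨w', hw', u₁, v₁, rfl, h1⟩ := hw none z ⟨[], v', hv, rfl⟩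
      have : u₁ = [] := by simpa using h1
      subst this
      exact ⟨[], (hL _ hw').next, rfl, rfl⟩
    | append_singleton u z ih =>
      intro v hv
      obtain ⟨hu, hu2⟩ := ih (z :: v) (by simpa using hv)
      obtain ⟨u₁, c1, l1, s1⟩ := hu2 z v rfl
      refine ⟨extend_step hGl hHl l1.symm s1.symm (bd _ hu) hu c1, ?_⟩
      rintro y v' rfl
      obtain ⟨w', hw', u₂, v₂, rfl, h2⟩ := hw (some z) y ⟨u ++ [z], v', hv, by simp⟩
      have hc2 := (hL _ hw').next
      rcases List.eq_nil_or_concat u₂ with rfl | ⟨u₃, b, rfl⟩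
      · simp at h2
      have hbz : b = z := by simpa using h2
      subst hbz
      rw [List.concat_eq_append] at *
      refine ⟨u₃ ++ [b], hc2, by simp, ?_⟩
      have hc3 := hc2.pre
      rw [shf_append, shf_append, hU b u₃ u₁ hc3 c1 (bd _ hc3.pre) (bd _ c1.pre), s1]
  exact (main w [] (by simp)).1

lemma level_bound {α : Type*} [Fintype α] (F : ℕ → Set α) (R : α → α → Prop)
    (hF : ∀ j q, q ∈ F (j + 1) ↔ ∃ p ∈ F j, R p q) :
    ∀ j q, q ∈ F j → ∃ k, k < Fintype.card α ∧ q ∈ F k := by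
  classical
  have lev : ∀ j q, (q ∈ F j ∧ ∀ i < j, q ∉ F i) →
      ∀ i ≤ j, ∃ p, p ∈ F i ∧ ∀ k < i, p ∉ F k := by
    intro j
    induction j with
    | zero => intro q hq i hi; obtain rfl : i = 0 := by omega
              exact ⟨q, hq⟩
    | succ j ih =>
      intro q hq i hi
      rcases Nat.lt_or_ge j i with h | h
      · obtain rfl : i = j + 1 := by omega
        exact ⟨q, hq⟩
      · obtain ⟨p, hp, hr⟩ := (hF j q).1 hq.1
        refine ih p ⟨hp, fun k hk hpk => hq.2 (k + 1) (by omega) ((hF k q).2 ⟨p, hpk, hr⟩)⟩ i h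
  intro j q hq
  have hex : ∃ j, q ∈ F j := ⟨j, hq⟩
  refine ⟨Nat.find hex, ?_, Nat.find_spec hex⟩
  have := lev (Nat.find hex) q ⟨Nat.find_spec hex, fun i hi => Nat.find_min hex hi⟩
  have hα : Nonempty α := ⟨q⟩
  choose! f hf1 hf2 using this
  have hinj : Function.Injective (fun i : Fin (Nat.find hex + 1) => f i) := by
    intro a b hab
    simp only at hab
    have ha := a.2
    have hb := b.2
    rcases lt_trichotomy (a : ℕ) b with h | h | h
    · exact absurd (hab ▸ hf1 a (by omega)) (hf2 b (by omega) a h)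
    · exact Fin.ext h
    · exact absurd (hab ▸ hf1 b (by omega)) (hf2 a (by omega) b h)
  have := Fintype.card_le_of_injective _ hinj
  rw [Fintype.card_fin] at this
  omega

/-- Transition relation on occurrences. -/
def OccR {X : Type*} (g : X → List X) (p q : Option X × X) : Prop :=
  ∃ u v, g p.2 = u ++ q.2 :: v ∧
    q.1 = (u.getLast?).or (p.1.bind fun a => (g a).getLast?)

lemma getLast_flatMap {X : Type*} {g : X → List X} (hne : ∀ a, g a ≠ []) (u : List X) :
    (u.flatMap g).getLast? = u.getLast?.bind fun a => (g a).getLast? := by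
  rcases List.eq_nil_or_concat u with rfl | ⟨u', a, rfl⟩
  · simp
  · simp [List.getLast?_append, List.getLast?_eq_some_getLast (hne a)]

lemma occ_step {X : Type*} {g : X → List X} (hne : ∀ a, g a ≠ []) (w : List X)
    (q : Option X × X) :
    Occ (applyM g w) q.1 q.2 ↔ ∃ p : Option X × X, Occ w p.1 p.2 ∧ OccR g p q := by
  constructor
  · rintro ⟨u, v, h1, h2⟩
    have aux : ∀ (w pre u v : List X), w.flatMap g = u ++ q.2 :: v →
        ∃ a z b, w = a ++ z :: b ∧ ∃ x y, g z = x ++ q.2 :: y ∧ u = a.flatMap g ++ x := by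
      intro w pre
      induction w with
      | nil => intro u v h; simp at h
      | cons c w ih =>
        intro u v h
        rw [List.flatMap_cons, List.append_eq_append_iff] at h
        rcases h with ⟨a', h, h'⟩ | ⟨c', h, h'⟩
        · obtain ⟨a, z, b, rfl, x, y, hz, hu⟩ := ih _ _ h'
          exact ⟨c :: a, z, b, rfl, x, y, hz, by simp [h, hu]⟩
        · cases c' with
          | nil =>
            simp only [List.nil_append] at h'
            obtain ⟨a, z, b, rfl, x, y, hz, hu⟩ := ih [] _ h'.symm
            refine ⟨c :: a, z, b, rfl, x, y, hz, ?_⟩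
            simp only [List.append_nil] at h
            rw [List.flatMap_cons, List.append_assoc, ← hu, h]; simp
          | cons y c'' =>
            simp only [List.cons_append, List.cons.injEq] at h'
            exact ⟨[], c, w, rfl, u, c'', by rw [h, h'.1], by simp⟩
    obtain ⟨a, z, b, rfl, x, y, hz, rfl⟩ := aux w [] u v h1
    refine ⟨(a.getLast?, z), ⟨a, b, rfl, rfl⟩, x, y, hz, ?_⟩
    rw [← h2, List.getLast?_append, getLast_flatMap hne]
  · rintro ⟨⟨o, z⟩, ⟨a, b, rfl, rfl⟩, x, y, hz, hq⟩
    refine ⟨a.flatMap g ++ x, y ++ b.flatMap g, ?_, ?_⟩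
    · simp only at hz
      simp [applyM, hz]
    · rw [hq, List.getLast?_append, getLast_flatMap hne]

lemma applyM_append {X : Type*} (g : X → List X) (u v : List X) :
    applyM g (u ++ v) = applyM g u ++ applyM g v := by simp [applyM]

lemma iterM_append {X : Type*} (g : X → List X) (k : ℕ) (u v : List X) :
    iterM g k (u ++ v) = iterM g k u ++ iterM g k v := by
  induction k generalizing u v with
  | zero => rfl
  | succ k ih =>
    simp only [iterM, Function.iterate_succ_apply] at *
    rw [applyM_append, ih]

lemma iterM_nil {X : Type*} (g : X → List X) (k : ℕ) : iterM g k [] = [] := by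
  induction k with
  | zero => rfl
  | succ k ih =>
    simp only [iterM, Function.iterate_succ_apply] at *
    simpa [applyM] using ih

lemma iterM_add {X : Type*} (g : X → List X) (j k : ℕ) (w : List X) :
    iterM g (j + k) w = iterM g j (iterM g k w) := by
  simp only [iterM, Function.iterate_add_apply]

lemma iterM_succ {X : Type*} (g : X → List X) (k : ℕ) (w : List X) :
    iterM g (k + 1) w = applyM g (iterM g k w) := by
  simp only [iterM, Function.iterate_succ_apply']

lemma flatMap_iter {X : Type*} (f g : X → List X) (k : ℕ) (w : List X) :
    applyM f (iterM g k w) = w.flatMap fun z => applyM f (iterM g k [z]) := by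
  induction w with
  | nil => rw [iterM_nil]; rfl
  | cons a w ih =>
    rw [List.flatMap_cons, ← ih, ← applyM_append, ← iterM_append]; rfl

lemma growing_ne {X : Type*} {g : X → List X} (hg : Growing g) (a : X) : g a ≠ [] := by
  intro h
  have h1 : ∀ i, (iterM g (i + 1) [a]).length = 0 := fun i => by
    rw [iterM_add]
    have : iterM g 1 [a] = [] := by simp [iterM, applyM, h]
    rw [this, iterM_nil]; rfl
  obtain ⟨i, hi⟩ := ((hg a).eventually (eventually_ge_atTop 1)).exists_forall_of_atTop
  have := hi (i + 1) (by omega)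
  rw [h1] at this; omega

lemma length_le_applyM {X : Type*} {g : X → List X} (hne : ∀ a, g a ≠ []) (c : ℕ) (f : X → List X)
    (hc : ∀ a, c ≤ (f a).length) (w : List X) : c * w.length ≤ (w.flatMap f).length := by
  induction w with
  | nil => simp
  | cons a w ih =>
    have := hc a
    simp only [List.length_cons, List.flatMap_cons, List.length_append, Nat.mul_add]
    omega

lemma two_le_iter {X : Type*} [Fintype X] {g : X → List X} (hg : Growing g) (z : X) :
    2 ≤ (iterM g (Fintype.card X) [z]).length := by
  by_contra hcon
  have hne := growing_ne hg
  have mono : Monotone fun i => (iterM g i [z]).length := by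
    apply monotone_nat_of_le_succ
    intro i
    have := length_le_applyM hne 1 g (fun a => List.length_pos_iff.2 (hne a)) (iterM g i [z])
    rw [iterM_succ]; unfold applyM; omega
  have h1 : ∀ i ≤ Fintype.card X, ∃ a, iterM g i [z] = [a] := by
    intro i hi
    have a1 := mono hi
    have a2 := mono (Nat.zero_le i)
    have a3 : (iterM g 0 [z]).length = 1 := rfl
    simp only at a1 a2
    exact List.length_eq_one_iff.1 (by omega)
  have hX : Nonempty X := ⟨z⟩
  choose! f hf using h1
  obtain ⟨i, j, hij, hfe⟩ := Fintype.exists_ne_map_eq_of_card_lt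
    (fun i : Fin (Fintype.card X + 1) => f i) (by simp)
  have key : ∀ i j : ℕ, i < j → i ≤ Fintype.card X → j ≤ Fintype.card X → f i = f j → False := by
    intro i j hij hi hj hfe
    have heq : iterM g j [z] = iterM g i [z] := by rw [hf i hi, hf j hj, hfe]
    have per : ∀ k, iterM g (i + k * (j - i)) [z] = iterM g i [z] := by
      intro k
      induction k with
      | zero => simp
      | succ k ih =>
        have : i + (k + 1) * (j - i) = (j - i) + (i + k * (j - i)) := by ring
        rw [this, iterM_add, ih, ← iterM_add]
        rw [show j - i + i = j by omega, heq]
    obtain ⟨N, hN⟩ := ((hg z).eventually (eventually_ge_atTop 2)).exists_forall_of_atTop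
    have hle : N ≤ i + N * (j - i) := by
      have : N * 1 ≤ N * (j - i) := Nat.mul_le_mul_left _ (by omega)
      omega
    have := hN _ hle
    rw [per, hf i hi] at this
    simp at this
  have hi := i.2
  have hj := j.2
  rcases lt_trichotomy (i : ℕ) j with h | h | h
  · exact key i j h (by omega) (by omega) hfe
  · exact hij (Fin.ext h)
  · exact key j i h (by omega) (by omega) hfe.symm

lemma four_le_iter {X : Type*} [Fintype X] {g : X → List X} (hg : Growing g) (z : X) :
    4 ≤ (iterM g (2 * Fintype.card X) [z]).length := by
  have h0 := two_le_iter hg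
  have := length_le_applyM (growing_ne hg) 2 (fun a => applyM (fun x => [x]) (iterM g (Fintype.card X) [a]))
    (by simpa [applyM] using h0) (iterM g (Fintype.card X) [z])
  rw [← flatMap_iter, ← iterM_add] at this
  have h2 := h0 z
  rw [two_mul]
  simp only [applyM, List.flatMap_singleton'] at this
  omega

lemma iter_occ {X : Type*} [Fintype X] {g : X → List X} (hg : Growing g) (w : List X) (j : ℕ)
    (o : Option X) (z : X) (h : Occ (iterM g j w) o z) :
    ∃ k, k < (Fintype.card X + 1) * Fintype.card X ∧ Occ (iterM g k w) o z := by
  obtain ⟨k, hk, hk'⟩ := level_bound (α := Option X × X)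
    (fun j => {q | Occ (iterM g j w) q.1 q.2}) (OccR g) (by
      intro j q
      simp only [Set.mem_ofPred_eq, iterM_succ]
      exact occ_step (growing_ne hg) _ q) j (o, z) h
  exact ⟨k, by simpa using hk, hk'⟩

/-- (Lemma 12 of the paper.) Under the stated hypotheses on
`t`, `d`, `e`, `B`, `m`, for every word `w` we have
`{g^i(w) : i ≥ 0} ⊆ COMP(g,h)` iff `{g^i(w) : 0 ≤ i ≤ e + 2n² + 2n - 3} ⊆ COMP(g,h)`. -/
theorem comp_iterates_finite_test {X : Type*} [Fintype X]
    (n : ℕ) (hn : n = Fintype.card X) (hn2 : 2 ≤ n)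
    (g h : X → List X) (hg : Growing g) (hh : Growing h)
    (t : ℕ) (ht : 2 ≤ t)
    (d : ℕ) (hd : 0 < d)
    (hper : ∀ z : X, ((iterM g d [z]).length : ℝ) / (t : ℝ) ≤ (PER (iterM g d [z]) : ℝ))
    (e : ℕ) (he : e = d + 2 * n - 1)
    (B : ℕ)
    (hB : B = Finset.univ.sup fun z : X =>
      (((applyM g (iterM g e [z])).length : ℤ) -
        ((applyM h (iterM g e [z])).length : ℤ)).natAbs)
    (m : ℕ) (hm : 0 < m)
    (hdm : ∀ z : X, 2 * t * m < (iterM g d [z]).length)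
    (hBm : (B : ℝ) ≤ (m : ℝ) / ((n : ℝ) ^ 2 + 1)) :
    ∀ w : List X,
      (∀ i : ℕ, iterM g i w ∈ COMP g h) ↔
        (∀ i : ℕ, i ≤ e + 2 * n ^ 2 + 2 * n - 3 → iterM g i w ∈ COMP g h) := by
  subst hn
  have hne := growing_ne hg
  intro w
  refine ⟨fun h i _ => h i, fun hfin i => ?_⟩
  by_cases hi : i ≤ e + 2 * Fintype.card X ^ 2 + 2 * Fintype.card X - 3
  · exact hfin i hi
  have hnn : (Fintype.card X) ^ 2 = Fintype.card X * Fintype.card X := sq _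
  set n := Fintype.card X with hn
  have hBm' : B * (n ^ 2 + 1) ≤ m := by
    rw [le_div_iff₀ (by positivity)] at hBm
    exact_mod_cast hBm
  have hnB : n * B ≤ m := by nlinarith
  have hB1 : B ≤ m := by nlinarith
  set G : X → List X := fun z => applyM g (iterM g e [z]) with hG
  set H : X → List X := fun z => applyM h (iterM g e [z]) with hH
  have hBz : ∀ z, (shf G H [z]).natAbs ≤ B := by
    intro z
    rw [hB]
    simp only [shf, List.flatMap_singleton]
    exact Finset.le_sup (f := fun z : X => (((applyM g (iterM g e [z])).length : ℤ) -
        ((applyM h (iterM g e [z])).length : ℤ)).natAbs) (Finset.mem_univ z)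
  have htm : 4 * m ≤ 2 * t * m := Nat.mul_le_mul_right _ (by omega)
  have hdec : ∀ z, ∃ x y b, G z = x ++ iterM g d [b] ++ y ∧ 4 * m ≤ x.length ∧
      4 * m ≤ y.length := by
    intro z
    have h4 := four_le_iter hg z
    have hGz : G z = iterM g d (iterM g (2 * n) [z]) := by
      rw [hG]
      simp only
      rw [← iterM_succ, ← iterM_add]
      congr 1; omega
    rw [← hn] at h4
    match hl : iterM g (2 * n) [z], h4 with
    | a :: b :: c :: r, _ =>
      refine ⟨iterM g d [a], iterM g d (c :: r), b, ?_, ?_, ?_⟩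
      · rw [hGz, hl, ← iterM_append, ← iterM_append]; rfl
      · have := hdm a; omega
      · have : c :: r = [c] ++ r := rfl
        rw [this, iterM_append, List.length_append]
        have := hdm c; omega
  have hU : UniqS G H m := by
    intro z p q hp hq hpm hqm
    obtain ⟨x, y, b, hGz, hx, hy⟩ := hdec z
    have hM : ∀ δ, δ ≤ 2 * m → ¬ HasPeriod (iterM g d [b]) δ := by
      intro δ hδ hP
      have h1 : PER (iterM g d [b]) ≤ δ := Nat.sInf_le hP
      have h2 := hper b
      rw [div_le_iff₀ (by positivity)] at h2
      have h3 : (iterM g d [b]).length ≤ PER (iterM g d [b]) * t := by exact_mod_cast h2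
      have h4 := hdm b
      nlinarith
    rcases lt_trichotomy (shf G H p) (shf G H q) with hlt | heq | hlt
    · exact (uniq_aux hGz (by omega) (by omega) (hBz z) hM hp hq hpm hqm hlt).elim
    · exact heq
    · exact (uniq_aux hGz (by omega) (by omega) (hBz z) hM hq hp hqm hpm hlt).elim
  have hGl : ∀ z, 8 * m ≤ (G z).length := by
    intro z
    obtain ⟨x, y, b, hGz, hx, hy⟩ := hdec z
    rw [hGz]; simp only [List.length_append]; omega
  have hHl : ∀ z, m ≤ (H z).length := by
    intro z
    have h1 := hGl z
    have h2 := hBz z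
    simp only [shf, List.flatMap_singleton] at h2
    omega
  have equ : ∀ j, iterM g (e + j) w ∈ COMP g h ↔ Cw G H (iterM g j w) := by
    intro j
    rw [iterM_add]
    unfold Cw
    rw [hG, hH, ← flatMap_iter, ← flatMap_iter]
    rfl
  obtain ⟨j, rfl⟩ : ∃ j, i = e + j := ⟨i - e, by omega⟩
  rw [equ]
  refine abstract_comp hU hBz hnB (fun z => by have := hGl z; omega) hHl
    {w' | ∃ k, k < (n + 1) * n ∧ w' = iterM g k w} ?_ _ ?_
  · rintro _ ⟨k, hk, rfl⟩
    rw [← equ]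
    apply hfin
    have : (n + 1) * n = n * n + n := by ring
    have : 2 * n ≤ n * n := Nat.mul_le_mul_right _ hn2
    omega
  · intro o z ho
    obtain ⟨k, hk, hk'⟩ := iter_occ hg w j o z ho
    exact ⟨_, ⟨k, hk, rfl⟩, hk'⟩
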